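/- arXiv:1201.6611 — 5 statements merged into one kernel-verified Lean document; each statement's English description precedes it below -/
import Mathlib

section
/- Let f : [0,1] → ℝ be continuous with −min(|M|, 1/m) ≤ f(t) ≤ 0 for all t. Then P(V_t ≤ f(t) for all t ∈ [0,1]) = 1 − E(sup_{t∈[0,1]} |f(t)| Z_t). -/
open MeasureTheory ProbabilityTheory Filter Set

/-- If `U` is uniform on `(0,1)` and independent of a `[0,1]`-valued `S`, then
`P(S ≤ U) = 1 - E S`. -/
theorem measureReal_le_uniform_eq_one_sub_integral
    {Ω : Type*} [MeasurableSpace Ω] {P : Measure Ω} [IsProbabilityMeasure P]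
    {U S : Ω → ℝ} (hU : Measurable U) (hS : Measurable S)
    (hUunif : P.map U = volume.restrict (Ioo (0:ℝ) 1)) (hindep : IndepFun S U P)
    (hS0 : ∀ ω, 0 ≤ S ω) (hS1 : ∀ ω, S ω ≤ 1) :
    P.real {ω | S ω ≤ U ω} = 1 - ∫ ω, S ω ∂P := by
  have hint : Integrable S P :=
    Integrable.of_bound hS.aestronglyMeasurable 1 (Eventually.of_forall fun ω => by
      rw [Real.norm_eq_abs, abs_of_nonneg (hS0 ω)]; exact hS1 ω)
  have hset : MeasurableSet {p : ℝ × ℝ | p.1 ≤ p.2} :=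
    measurableSet_le measurable_fst measurable_snd
  have htail : ∀ ω, P.map U (Ici (S ω)) = ENNReal.ofReal (1 - S ω) := fun ω => by
    have hIcc : Ici (S ω) ∩ Icc 0 1 = Icc (S ω) 1 := by
      ext x
      simp only [mem_inter_iff, mem_Ici, mem_Icc]
      exact ⟨fun h => ⟨h.1, h.2.2⟩, fun h => ⟨h.1, (hS0 ω).trans h.1, h.2⟩⟩
    rw [hUunif, Measure.restrict_congr_set Ioo_ae_eq_Icc,
      Measure.restrict_apply measurableSet_Ici, hIcc, Real.volume_Icc]
  have hprod : P {ω | S ω ≤ U ω} = ENNReal.ofReal (∫ ω, (1 - S ω) ∂P) := by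
    have := Measure.isProbabilityMeasure_map (μ := P) hU.aemeasurable
    calc P {ω | S ω ≤ U ω} = P.map (fun ω => (S ω, U ω)) {p | p.1 ≤ p.2} :=
          (Measure.map_apply (hS.prodMk hU) hset).symm
      _ = ∫⁻ s, P.map U (Ici s) ∂(P.map S) := by
          rw [(indepFun_iff_map_prod_eq_prod_map_map hS.aemeasurable hU.aemeasurable).1 hindep,
            Measure.prod_apply hset]
          rfl
      _ = ∫⁻ ω, P.map U (Ici (S ω)) ∂P :=
          lintegral_map (measurable_measure_prodMk_left hset) hS
      _ = ENNReal.ofReal (∫ ω, (1 - S ω) ∂P) := by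
          simp_rw [htail]
          exact (ofReal_integral_eq_lintegral_ofReal ((integrable_const 1).sub hint)
            (Eventually.of_forall fun ω => sub_nonneg.2 (hS1 ω))).symm
  rw [measureReal_def, hprod,
    ENNReal.toReal_ofReal (integral_nonneg fun ω => sub_nonneg.2 (hS1 ω)),
    integral_sub (integrable_const 1) hint]
  simp

/-- **Functional df of a standard generalized Pareto process.**
Let `(Ω, 𝔄, P)` be a probability space, `m ≥ 1`, `M < 0`.  Let `Z = (Z t)_{t ∈ [0,1]}`
be a stochastic process with continuous sample paths, `0 < Z t ω ≤ m`, and let `U` be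
uniformly distributed on `(0,1)` and independent of `Z`.  Put `V t := max (−U / Z t) M`.
Then for every continuous `f : [0,1] → ℝ` with `−min (|M|, 1/m) ≤ f t ≤ 0` for all `t`,
`P(V ≤ f) = 1 − E (sup_{t ∈ [0,1]} |f t| * Z t)`. -/
theorem gpp_functional_df
    {Ω : Type*} [MeasurableSpace Ω] (P : Measure Ω) [IsProbabilityMeasure P]
    (m M : ℝ) (hm : 1 ≤ m) (hM : M < 0)
    (Z : Icc (0:ℝ) 1 → Ω → ℝ)
    (hZcont : ∀ ω, Continuous fun t : Icc (0:ℝ) 1 => Z t ω)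
    (hZmeas : ∀ t, Measurable (Z t))
    (hZpos : ∀ t ω, 0 < Z t ω) (hZbdd : ∀ t ω, Z t ω ≤ m)
    (U : Ω → ℝ) (hUmeas : Measurable U)
    (hUunif : P.map U = volume.restrict (Ioo (0:ℝ) 1))
    (hindep : IndepFun U (fun ω => fun t : Icc (0:ℝ) 1 => Z t ω) P)
    (V : Icc (0:ℝ) 1 → Ω → ℝ)
    (hV : ∀ t ω, V t ω = max (-(U ω) / Z t ω) M)
    (f : Icc (0:ℝ) 1 → ℝ) (hfcont : Continuous f)
    (hf : ∀ t, -(min |M| (1/m)) ≤ f t ∧ f t ≤ 0) :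
    (P {ω | ∀ t : Icc (0:ℝ) 1, V t ω ≤ f t}).toReal
      = 1 - ∫ ω, (⨆ t : Icc (0:ℝ) 1, |f t| * Z t ω) ∂P := by
  have hfM : ∀ t, |f t| ≤ |M| := fun t => by
    rw [abs_of_nonpos (hf t).2]
    linarith [(hf t).1, min_le_left |M| (1 / m)]
  have hfm : ∀ t, |f t| ≤ 1 / m := fun t => by
    rw [abs_of_nonpos (hf t).2]
    linarith [(hf t).1, min_le_right |M| (1 / m)]
  have hle : ∀ t ω, |f t| * Z t ω ≤ 1 := fun t ω => by
    calc |f t| * Z t ω ≤ 1 / m * m :=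
          mul_le_mul (hfm t) (hZbdd t ω) (hZpos t ω).le (by positivity)
      _ = 1 := by field_simp
  have hbdd : ∀ ω, BddAbove (range fun t => |f t| * Z t ω) := fun ω =>
    ⟨1, forall_mem_range.2 fun t => hle t ω⟩
  have hevent : {ω | ∀ t, V t ω ≤ f t} = {ω | (⨆ t, |f t| * Z t ω) ≤ U ω} := by
    ext ω
    simp only [mem_ofPred_eq]
    rw [ciSup_le_iff (hbdd ω)]
    refine forall_congr' fun t => ?_
    have hMf : M ≤ f t := by
      have := hfM t
      rw [abs_of_neg hM, abs_of_nonpos (hf t).2] at this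
      linarith
    rw [hV, max_le_iff, and_iff_left hMf, div_le_iff₀ (hZpos t ω), abs_of_nonpos (hf t).2,
      neg_mul, neg_le]
  obtain ⟨D, hDcount, hDdense⟩ := TopologicalSpace.exists_countable_dense (Icc (0:ℝ) 1)
  have : Countable D := hDcount.to_subtype
  have hsup : (fun ω => ⨆ t, |f t| * Z t ω)
      = (fun z : Icc (0:ℝ) 1 → ℝ => ⨆ t : D, |f t| * z t) ∘ fun ω t => Z t ω := by
    ext ω
    exact (hDdense.ciSup' (hfcont.abs.mul (hZcont ω))).symm
  have hg : Measurable fun z : Icc (0:ℝ) 1 → ℝ => ⨆ t : D, |f t| * z t :=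
    Measurable.iSup fun t => (measurable_pi_apply _).const_mul _
  rw [hevent]
  refine measureReal_le_uniform_eq_one_sub_integral hUmeas ?_ hUunif ?_
    (fun ω => Real.iSup_nonneg fun t => mul_nonneg (abs_nonneg _) (hZpos t ω).le)
    (fun ω => ciSup_le fun t => hle t ω)
  · rw [hsup]
    exact hg.comp (measurable_pi_lambda _ hZmeas)
  · rw [hsup]
    exact (hindep.comp measurable_id hg).symm
end

section
/- Let W ≥ 0 be a random variable with distribution function H (i.e. H(x) = P(W ≤ x)), let Z = (Z_t)_{t∈[0,1]} be a stochastic process with continuous sample paths satisfying 0 < Z_t(ω) ≤ m for all t, ω, independent of W, let M < 0 and define X_t := max(−W/Z_t, M). Let ν denote the distribution of inf_{t∈[0,1]} Z_t. Then for every c with M < c < 0 and every u ∈ [0,1]: P(X_t ≥ c·u for all t ∈ [0,1]) = ∫_{[0,m]} H(|c| z u) dν(z). -/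
open MeasureTheory ProbabilityTheory Set

/-- A random variable independent of a process with continuous paths is independent of the
pointwise infimum of that process. -/
theorem indepFun_iInf_of_continuous {Ω T β : Type*} [MeasurableSpace Ω] [MeasurableSpace β]
    [TopologicalSpace T] [TopologicalSpace.SeparableSpace T] {P : Measure Ω}
    {W : Ω → β} {Z : T → Ω → ℝ} (hZ : ∀ ω, Continuous fun t => Z t ω)
    (h : IndepFun W (fun ω t => Z t ω) P) :
    IndepFun W (fun ω => ⨅ t, Z t ω) P := by
  obtain ⟨D, hD, hdense⟩ := TopologicalSpace.exists_countable_dense T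
  have := hD.to_subtype
  have hinf : Measurable fun f : T → ℝ => ⨅ d : D, f d :=
    Measurable.iInf fun d => measurable_pi_apply (d : T)
  have heq : (fun ω => ⨅ t, Z t ω) = (fun f : T → ℝ => ⨅ d : D, f d) ∘ fun ω t => Z t ω :=
    funext fun ω => (hdense.ciInf' (hZ ω)).symm
  rw [heq]
  exact h.comp measurable_id hinf

/-- For independent `W` and `Y`, the probability of `W ≤ g Y` is obtained by integrating the
distribution function of `W` against the law of `Y`. -/
theorem measureReal_le_comp_eq_integral {Ω β : Type*} [MeasurableSpace Ω] [MeasurableSpace β]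
    {P : Measure Ω} [IsProbabilityMeasure P] {W : Ω → ℝ} {Y : Ω → β} (hW : Measurable W)
    (hY : Measurable Y) (h : IndepFun W Y P) {g : β → ℝ} (hg : Measurable g) :
    P.real {ω | W ω ≤ g (Y ω)} = ∫ y, P.real {ω | W ω ≤ g y} ∂(P.map Y) := by
  have hS : MeasurableSet {p : β × ℝ | p.2 ≤ g p.1} :=
    measurableSet_le measurable_snd (hg.comp measurable_fst)
  have hWprob := Measure.isProbabilityMeasure_map (μ := P) hW.aemeasurable
  have hslice (y : β) : P {ω | W ω ≤ g y} = P.map W (Prod.mk y ⁻¹' {p | p.2 ≤ g p.1}) := by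
    rw [Measure.map_apply hW (measurable_prodMk_left hS)]
    rfl
  have hjoint : P {ω | W ω ≤ g (Y ω)} = ∫⁻ y, P {ω | W ω ≤ g y} ∂(P.map Y) := by
    simp_rw [hslice]
    rw [← Measure.prod_apply hS,
      ← (indepFun_iff_map_prod_eq_prod_map_map hY.aemeasurable hW.aemeasurable).1 h.symm,
      Measure.map_apply (hY.prodMk hW) hS]
    rfl
  simp only [measureReal_def]
  rw [integral_toReal _ (Filter.Eventually.of_forall fun _ => measure_lt_top _ _), hjoint]
  simp_rw [hslice]
  exact (measurable_measure_prodMk_left hS).aemeasurable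

/-- Below the threshold `a`, the truncation of `-w / z` at `M` plays no role. -/
theorem le_max_neg_div_iff {a M w z : ℝ} (hM : M < a) (hz : 0 < z) :
    a ≤ max (-w / z) M ↔ w ≤ -a * z := by
  rw [le_max_iff, or_iff_left hM.not_ge, le_div_iff₀ hz]
  constructor <;> intro h <;> linarith

/-- **Exceedance probability by conditioning on the infimum of the generator.**
Let `W ≥ 0` be a random variable with distribution function `H`, let
`Z = (Z t)_{t ∈ [0,1]}` be a process with continuous sample paths and
`0 < Z t ω ≤ m`, independent of `W`, let `M < 0` and `X t := max (−W / Z t) M`.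
Let `ν` be the distribution of `inf_{t ∈ [0,1]} Z t`.  Then for every `c` with
`M < c < 0` and every `u ∈ [0,1]`,
`P(X t ≥ c u for all t) = ∫_{[0,m]} H (|c| z u) dν(z)`. -/
theorem exceedance_prob_eq_integral
    {Ω : Type*} [MeasurableSpace Ω] (P : Measure Ω) [IsProbabilityMeasure P]
    (m M : ℝ) (hm : 1 ≤ m) (hM : M < 0)
    (W : Ω → ℝ) (hWmeas : Measurable W) (hWnonneg : ∀ ω, 0 ≤ W ω)
    (Z : Icc (0:ℝ) 1 → Ω → ℝ)
    (hZcont : ∀ ω, Continuous fun t : Icc (0:ℝ) 1 => Z t ω)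
    (hZmeas : ∀ t, Measurable (Z t))
    (hZpos : ∀ t ω, 0 < Z t ω) (hZbdd : ∀ t ω, Z t ω ≤ m)
    (hindep : IndepFun W (fun ω => fun t : Icc (0:ℝ) 1 => Z t ω) P)
    (hinfmeas : Measurable fun ω => ⨅ t : Icc (0:ℝ) 1, Z t ω)
    (X : Icc (0:ℝ) 1 → Ω → ℝ)
    (hX : ∀ t ω, X t ω = max (-(W ω) / Z t ω) M)
    (H : ℝ → ℝ) (hH : ∀ x, H x = (P {ω | W ω ≤ x}).toReal)
    (ν : Measure ℝ) (hν : ν = P.map fun ω => ⨅ t : Icc (0:ℝ) 1, Z t ω)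
    (c : ℝ) (hMc : M < c) (hc : c < 0) (u : ℝ) (hu : u ∈ Icc (0:ℝ) 1) :
    (P {ω | ∀ t : Icc (0:ℝ) 1, c * u ≤ X t ω}).toReal
      = ∫ z in Icc (0:ℝ) m, H (|c| * z * u) ∂ν := by
  have hbdd (ω : Ω) : BddBelow (range fun t => Z t ω) :=
    ⟨0, by rintro _ ⟨t, rfl⟩; exact (hZpos t ω).le⟩
  have hMcu : M < c * u := by nlinarith [hu.1, hu.2]
  have hcu : 0 ≤ |c| * u := mul_nonneg (abs_nonneg c) hu.1
  have hevent : {ω | ∀ t : Icc (0:ℝ) 1, c * u ≤ X t ω}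
      = {ω | W ω ≤ |c| * (⨅ t : Icc (0:ℝ) 1, Z t ω) * u} := by
    ext ω
    simp only [mem_ofPred_eq, hX, le_max_neg_div_iff hMcu (hZpos _ ω)]
    rw [mul_right_comm, Real.mul_iInf_of_nonneg hcu, le_ciInf_iff]
    · simp only [abs_of_neg hc, neg_mul]
    · refine ⟨0, ?_⟩
      rintro _ ⟨t, rfl⟩
      exact mul_nonneg hcu (hZpos t ω).le
  have hsupp : ∀ᵐ z ∂ν, z ∈ Icc (0:ℝ) m := by
    rw [hν]
    refine (ae_map_iff hinfmeas.aemeasurable (p := fun z => z ∈ Icc (0:ℝ) m)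
      measurableSet_Icc).2 ?_
    exact Filter.Eventually.of_forall fun ω =>
      ⟨le_ciInf fun t => (hZpos t ω).le, (ciInf_le (hbdd ω) 0).trans (hZbdd 0 ω)⟩
  rw [Measure.restrict_eq_self_of_ae_mem hsupp, hν, hevent]
  simp_rw [hH]
  exact measureReal_le_comp_eq_integral hWmeas hinfmeas
    (indepFun_iInf_of_continuous hZcont hindep)
    (g := fun z => |c| * z * u) (by fun_prop)
end

section
/- For every ε > 0 there exists c* ∈ [−u0/m, 0) such that for all c ∈ (c*, 0), all u ∈ [0,1] and all θ with 0 < |θ| ≤ ε0: | ∫_{[0,m]} z h_θ(|c| z u) dν(z) − A − θ |c|^δ u^δ B | ≤ ε |θ| |c|^δ. In particular, ∫_{[0,m]} z h_0(|c| z u) dν(z) = A for all such c and u. -/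
open MeasureTheory Set

/-- If `F` differs from `z + K * z ^ p` by at most `C` on `[0, m]`, then its integral over `[0, m]`
against a probability measure differs by at most `C` from that of `z + K * z ^ p`. -/
theorem abs_setIntegral_sub_affine_rpow_le {m p K C : ℝ} (hp : 0 ≤ p)
    (ν : Measure ℝ) [IsProbabilityMeasure ν] {F : ℝ → ℝ} (hF : Measurable F)
    (hbound : ∀ z ∈ Icc (0:ℝ) m, |F z - z - K * z ^ p| ≤ C) (hC : 0 ≤ C) :
    |(∫ z in Icc (0:ℝ) m, F z ∂ν) - (∫ z in Icc (0:ℝ) m, z ∂ν)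
      - K * ∫ z in Icc (0:ℝ) m, z ^ p ∂ν| ≤ C := by
  have hid : IntegrableOn (fun z : ℝ => z) (Icc 0 m) ν :=
    continuous_id.continuousOn.integrableOn_compact isCompact_Icc
  have hpow : IntegrableOn (fun z : ℝ => K * z ^ p) (Icc 0 m) ν :=
    ((Real.continuous_rpow_const hp).const_mul K).continuousOn.integrableOn_compact isCompact_Icc
  have hdiff : IntegrableOn (fun z => F z - z - K * z ^ p) (Icc 0 m) ν := by
    refine Measure.integrableOn_of_bounded (M := C) (measure_ne_top _ _) ?_ ?_
    · exact (by fun_prop : Measurable fun z => F z - z - K * z ^ p).aestronglyMeasurable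
    · exact (ae_restrict_iff' measurableSet_Icc).2 (.of_forall hbound)
  have hFint : IntegrableOn F (Icc 0 m) ν := by
    refine ((hdiff.add hpow).add hid).congr (.of_forall fun z => ?_)
    simp only [Pi.add_apply]
    ring
  have hsplit : (∫ z in Icc (0:ℝ) m, F z ∂ν) - (∫ z in Icc (0:ℝ) m, z ∂ν)
      - K * ∫ z in Icc (0:ℝ) m, z ^ p ∂ν = ∫ z in Icc (0:ℝ) m, (F z - z - K * z ^ p) ∂ν := by
    have hsub : IntegrableOn (fun z => F z - z) (Icc 0 m) ν := hFint.sub hid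
    rw [integral_sub hsub hpow, integral_sub hFint hid, integral_const_mul]
  rw [hsplit, ← Real.norm_eq_abs]
  calc ‖∫ z in Icc (0:ℝ) m, (F z - z - K * z ^ p) ∂ν‖
      ≤ C * ν.real (Icc 0 m) := norm_setIntegral_le_of_norm_le_const (measure_lt_top _ _) hbound
    _ ≤ C := mul_le_of_le_one_right hC measureReal_le_one

/-- **Uniform expansion of the exceedance density in the δ-model.**
With `A := ∫_{[0,m]} z dν`, `B := ∫_{[0,m]} z^{1+δ} dν`, `A > 0`, and densities
`h_θ(u) = 1 + θ u^δ + r_θ(u)` with `r_θ(u) = o(θ u^δ)` uniformly for `0 < |θ| ≤ ε0`: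
for every `ε > 0` there is `c* ∈ [−u0/m, 0)` such that for all `c ∈ (c*, 0)`,
`u ∈ [0,1]` and `0 < |θ| ≤ ε0`,
`| ∫_{[0,m]} z h_θ(|c| z u) dν(z) − A − θ |c|^δ u^δ B | ≤ ε |θ| |c|^δ`;
in particular `∫_{[0,m]} z h_0(|c| z u) dν(z) = A`. -/
theorem density_expansion_delta_model
    (m δ : ℝ) (hm : 1 ≤ m) (hδ : δ ∈ Ioc (0:ℝ) 1)
    (ν : Measure ℝ) [IsProbabilityMeasure ν] (hν : ν (Icc (0:ℝ) m)ᶜ = 0)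
    (A B : ℝ) (hA : A = ∫ z in Icc (0:ℝ) m, z ∂ν) (hApos : 0 < A)
    (hB : B = ∫ z in Icc (0:ℝ) m, z ^ (1 + δ) ∂ν)
    (u0 ε0 : ℝ) (hu0 : u0 ∈ Ioo (0:ℝ) 1) (hε0 : 0 < ε0)
    (h : ℝ → ℝ → ℝ) (hmeas : ∀ θ, Measurable (h θ))
    (hnonneg : ∀ θ ∈ Icc (-ε0) ε0, ∀ u ∈ Icc (0:ℝ) u0, 0 ≤ h θ u)
    (h0 : ∀ u ∈ Icc (0:ℝ) u0, h 0 u = 1)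
    (hr0 : ∀ θ ∈ Icc (-ε0) ε0, h θ 0 = 1)
    (hr : ∀ ε > 0, ∃ u1 > 0, ∀ u, 0 < u → u ≤ u1 → ∀ θ : ℝ, 0 < |θ| → |θ| ≤ ε0 →
        |h θ u - 1 - θ * u ^ δ| ≤ ε * |θ| * u ^ δ) :
    (∀ ε > 0, ∃ cstar ∈ Ico (-(u0 / m)) 0, ∀ c ∈ Ioo cstar 0, ∀ u ∈ Icc (0:ℝ) 1,
        ∀ θ : ℝ, 0 < |θ| → |θ| ≤ ε0 →
          |(∫ z in Icc (0:ℝ) m, z * h θ (|c| * z * u) ∂ν)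
              - A - θ * |c| ^ δ * u ^ δ * B| ≤ ε * |θ| * |c| ^ δ) ∧
    (∀ c, -(u0 / m) ≤ c → c < 0 → ∀ u ∈ Icc (0:ℝ) 1,
        (∫ z in Icc (0:ℝ) m, z * h 0 (|c| * z * u) ∂ν) = A) := by
  obtain ⟨hδ0, -⟩ := hδ
  have hm0 : 0 < m := by linarith
  have harg : ∀ c z u : ℝ, z ∈ Icc 0 m → u ∈ Icc (0:ℝ) 1 →
      0 ≤ |c| * z * u ∧ |c| * z * u ≤ |c| * m := fun c z u hz hu => by
    have hcz : 0 ≤ |c| * z := mul_nonneg (abs_nonneg c) hz.1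
    exact ⟨mul_nonneg hcz hu.1, (mul_le_of_le_one_right hcz hu.2).trans
      (mul_le_mul_of_nonneg_left hz.2 (abs_nonneg c))⟩
  constructor
  · intro ε hε
    have hD : 0 < m ^ (1 + δ) := Real.rpow_pos_of_pos hm0 _
    obtain ⟨u1, hu1, H⟩ := hr (ε / m ^ (1 + δ)) (div_pos hε hD)
    have hmin : 0 < min (u0 / m) (u1 / m) := lt_min (div_pos hu0.1 hm0) (div_pos hu1 hm0)
    refine ⟨-min (u0 / m) (u1 / m), ⟨neg_le_neg (min_le_left _ _), neg_neg_of_pos hmin⟩, ?_⟩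
    intro c hc u hu θ hθ0 hθ
    have hcm : |c| * m ≤ u1 := by
      rw [abs_of_neg hc.2, ← le_div_iff₀ hm0]
      linarith [hc.1, min_le_right (u0 / m) (u1 / m)]
    have hcδ : 0 ≤ |c| ^ δ := by positivity
    rw [hA, hB]
    refine abs_setIntegral_sub_affine_rpow_le (by linarith) ν
      (measurable_id.mul ((hmeas θ).comp (by fun_prop))) (fun z hz => ?_) (by positivity)
    obtain ⟨hx0, hxm⟩ := harg c z u hz hu
    have hz0 := hz.1
    have hu00 := hu.1
    have hfactor : z * h θ (|c| * z * u) - z - θ * |c| ^ δ * u ^ δ * z ^ (1 + δ)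
        = z * (h θ (|c| * z * u) - 1 - θ * (|c| * z * u) ^ δ) := by
      rw [Real.rpow_one_add' hz0 (by linarith), Real.mul_rpow (by positivity) hu00,
        Real.mul_rpow (abs_nonneg c) hz0]
      ring
    have hrem : |h θ (|c| * z * u) - 1 - θ * (|c| * z * u) ^ δ|
        ≤ ε / m ^ (1 + δ) * |θ| * (|c| * z * u) ^ δ := by
      rcases hx0.eq_or_lt with hx | hx
      · rw [← hx, hr0 θ (abs_le.1 hθ), Real.zero_rpow hδ0.ne']
        simp
      · exact H _ hx (hxm.trans hcm) θ hθ0 hθ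
    calc |z * h θ (|c| * z * u) - z - θ * |c| ^ δ * u ^ δ * z ^ (1 + δ)|
        = z * |h θ (|c| * z * u) - 1 - θ * (|c| * z * u) ^ δ| := by
          rw [hfactor, abs_mul, abs_of_nonneg hz0]
      _ ≤ m * (ε / m ^ (1 + δ) * |θ| * (|c| * m) ^ δ) := by
          refine mul_le_mul hz.2 (hrem.trans ?_) (abs_nonneg _) hm0.le
          gcongr
      _ = ε * |θ| * |c| ^ δ := by
          have hmδ : 0 < m ^ δ := Real.rpow_pos_of_pos hm0 _
          rw [Real.mul_rpow (abs_nonneg c) hm0.le, Real.rpow_one_add' hm0.le (by linarith)]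
          field_simp
  · intro c hc hc0 u hu
    rw [hA]
    refine setIntegral_congr_fun measurableSet_Icc fun z hz => ?_
    obtain ⟨hx0, hxm⟩ := harg c z u hz hu
    have hcm : |c| * m ≤ u0 := by
      rw [abs_of_neg hc0, ← le_div_iff₀ hm0]
      linarith
    simp only [h0 _ ⟨hx0, hxm.trans hcm⟩, mul_one]
end

section
/- Let ξ ∈ ℝ and let (c_n) be a sequence in (−∞,0) with c_n → 0 and n|c_n|^{1+2δ} → ∞; set θ_n := ξ/√(n |c_n|^{1+2δ}). Then, as n → ∞, √(n|c_n|) · ∫_0^1 Φ^{−1}(u) · (f_{θ_n,c_n}(u)/p(θ_n,c_n)) du → ξ (B/A) ∫_ℝ x Φ(x)^δ φ(x) dx, and ∫_0^1 (Φ^{−1}(u))² · (f_{θ_n,c_n}(u)/p(θ_n,c_n)) du → 1. -/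
open MeasureTheory ProbabilityTheory Filter Set

/-- The standard normal distribution function `Φ`. -/
noncomputable def stdNormalCDF : ℝ → ℝ :=
  fun x => ((gaussianReal 0 1) (Iic x)).toReal

/-- The standard normal quantile function `Φ⁻¹`. -/
noncomputable def stdNormalQuantile : ℝ → ℝ :=
  Function.invFun stdNormalCDF

theorem stdNormalCDF_eq_integral (x : ℝ) :
    stdNormalCDF x = ∫ t in Iic x, gaussianPDFReal 0 1 t := by
  rw [stdNormalCDF, gaussianReal_apply_eq_integral _ one_ne_zero, ENNReal.toReal_ofReal]
  exact integral_nonneg fun t => gaussianPDFReal_nonneg 0 1 t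

theorem hasDerivAt_stdNormalCDF (x : ℝ) :
    HasDerivAt stdNormalCDF (gaussianPDFReal 0 1 x) x := by
  have hint := integrable_gaussianPDFReal 0 1
  have hcont : Continuous (gaussianPDFReal 0 1) := by
    rw [gaussianPDFReal_def]; fun_prop
  have heq : stdNormalCDF = fun y =>
      stdNormalCDF 0 + ∫ t in (0:ℝ)..y, gaussianPDFReal 0 1 t := by
    funext y
    rw [← intervalIntegral.integral_Iic_sub_Iic hint.integrableOn hint.integrableOn,
      stdNormalCDF_eq_integral, stdNormalCDF_eq_integral]
    ring
  rw [heq]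
  exact (intervalIntegral.integral_hasDerivAt_right hint.intervalIntegrable
    hcont.stronglyMeasurable.stronglyMeasurableAtFilter hcont.continuousAt).const_add _

theorem strictMono_stdNormalCDF : StrictMono stdNormalCDF :=
  strictMono_of_hasDerivAt_pos hasDerivAt_stdNormalCDF
    fun x => gaussianPDFReal_pos 0 1 x one_ne_zero

theorem stdNormalQuantile_stdNormalCDF (x : ℝ) : stdNormalQuantile (stdNormalCDF x) = x :=
  Function.leftInverse_invFun strictMono_stdNormalCDF.injective x

theorem stdNormalCDF_eq_cdf : stdNormalCDF = cdf (gaussianReal 0 1) := by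
  funext x
  rw [cdf_eq_real, measureReal_def, stdNormalCDF]

theorem stdNormalCDF_image_univ : stdNormalCDF '' univ = Ioo 0 1 := by
  have hbot : Tendsto stdNormalCDF atBot (nhds 0) :=
    stdNormalCDF_eq_cdf ▸ tendsto_cdf_atBot _
  have htop : Tendsto stdNormalCDF atTop (nhds 1) :=
    stdNormalCDF_eq_cdf ▸ tendsto_cdf_atTop _
  have hcont : Continuous stdNormalCDF :=
    continuous_iff_continuousAt.2 fun x => (hasDerivAt_stdNormalCDF x).continuousAt
  apply Subset.antisymm
  · rintro _ ⟨x, -, rfl⟩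
    constructor
    · exact (strictMono_stdNormalCDF.monotone.le_of_tendsto hbot (x - 1)).trans_lt
        (strictMono_stdNormalCDF (by linarith))
    · exact (strictMono_stdNormalCDF (by linarith)).trans_le
        (strictMono_stdNormalCDF.monotone.ge_of_tendsto htop (x + 1))
  · rintro y ⟨hy0, hy1⟩
    obtain ⟨a, ha⟩ := (hbot.eventually_lt_const hy0).exists
    obtain ⟨b, hb⟩ := (htop.eventually_const_lt hy1).exists
    obtain ⟨x, hx⟩ := mem_range_of_exists_le_of_exists_ge hcont ⟨a, ha.le⟩ ⟨b, hb.le⟩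
    exact ⟨x, mem_univ x, hx⟩

theorem integral_Ioo_comp_stdNormalQuantile (g : ℝ → ℝ) :
    ∫ u in Ioo (0:ℝ) 1, g u = ∫ x, gaussianPDFReal 0 1 x * g (stdNormalCDF x) := by
  rw [← stdNormalCDF_image_univ, integral_image_eq_integral_abs_deriv_smul MeasurableSet.univ
    (fun x _ => (hasDerivAt_stdNormalCDF x).hasDerivWithinAt)
    strictMono_stdNormalCDF.injective.injOn]
  simp [abs_of_nonneg (gaussianPDFReal_nonneg 0 1 _)]

theorem integrableOn_stdNormalQuantile_pow (k : ℕ) :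
    IntegrableOn (fun u => stdNormalQuantile u ^ k) (Ioo 0 1) := by
  rw [← stdNormalCDF_image_univ, integrableOn_image_iff_integrableOn_abs_deriv_smul
    MeasurableSet.univ (fun x _ => (hasDerivAt_stdNormalCDF x).hasDerivWithinAt)
    strictMono_stdNormalCDF.injective.injOn, integrableOn_univ]
  have hint : Integrable (fun x : ℝ => x ^ k) (gaussianReal 0 1) :=
    (memLp_id_gaussianReal (μ := 0) (v := 1) k).integrable_norm_pow'.mono'
      (by fun_prop) (ae_of_all _ fun x => by simp)
  rw [gaussianReal_of_var_ne_zero _ one_ne_zero, integrable_withDensity_iff_integrable_smul'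
    (measurable_gaussianPDF 0 1) (ae_of_all _ fun _ => gaussianPDF_lt_top)] at hint
  refine hint.congr (ae_of_all _ fun x => ?_)
  simp [toReal_gaussianPDF, stdNormalQuantile_stdNormalCDF,
    abs_of_nonneg (gaussianPDFReal_nonneg 0 1 _)]

theorem integral_stdNormalQuantile : ∫ u in Ioo (0:ℝ) 1, stdNormalQuantile u = 0 := by
  have := integral_gaussianReal_eq_integral_smul (μ := 0) (v := 1) (f := fun x : ℝ => x)
    one_ne_zero
  rw [integral_id_gaussianReal] at this
  rw [integral_Ioo_comp_stdNormalQuantile]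
  simpa [stdNormalQuantile_stdNormalCDF] using this.symm

theorem integral_stdNormalQuantile_sq : ∫ u in Ioo (0:ℝ) 1, stdNormalQuantile u ^ 2 = 1 := by
  have := integral_gaussianReal_eq_integral_smul (μ := 0) (v := 1) (f := fun x : ℝ => x ^ 2)
    one_ne_zero
  rw [← variance_of_integral_eq_zero (by fun_prop) integral_id_gaussianReal,
    variance_fun_id_gaussianReal] at this
  rw [integral_Ioo_comp_stdNormalQuantile]
  simpa [stdNormalQuantile_stdNormalCDF] using this.symm

theorem integral_stdNormalQuantile_mul_rpow (δ : ℝ) :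
    ∫ u in Ioo (0:ℝ) 1, stdNormalQuantile u * u ^ δ =
      ∫ x, x * stdNormalCDF x ^ δ * gaussianPDFReal 0 1 x := by
  rw [integral_Ioo_comp_stdNormalQuantile]
  simp only [stdNormalQuantile_stdNormalCDF]
  congr with x
  ring

/-- A weighted mean of a kernel `k` with `k v = 1 + θ v ^ δ` up to a relative error `ε` inherits
the expansion. -/
theorem abs_integral_mul_comp_sub_le {m δ : ℝ} (hδ : 0 < δ) (μ : Measure ℝ) [IsFiniteMeasure μ]
    (hμ : ∀ᵐ z ∂μ, z ∈ Icc (0:ℝ) m) {k : ℝ → ℝ} (hk : Measurable k) {a θ ε : ℝ} (ha : 0 ≤ a)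
    (hexp : ∀ v ∈ Icc 0 (a * m), |k v - 1 - θ * v ^ δ| ≤ ε * |θ| * v ^ δ)
    {u : ℝ} (hu : u ∈ Icc (0:ℝ) 1) :
    |(∫ z, z * k (a * z * u) ∂μ) - (∫ z, z ∂μ) - θ * a ^ δ * (∫ z, z ^ (1 + δ) ∂μ) * u ^ δ|
      ≤ ε * |θ| * a ^ δ * (∫ z, z ^ (1 + δ) ∂μ) * u ^ δ := by
  have hbdd : ∀ {g : ℝ → ℝ} {C : ℝ}, Measurable g → (∀ z ∈ Icc (0:ℝ) m, |g z| ≤ C) →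
      Integrable g μ := fun hg hC =>
    Integrable.of_bound hg.aestronglyMeasurable _ (hμ.mono fun z hz => hC z hz)
  have hi1 : Integrable (fun z : ℝ => z) μ :=
    hbdd (C := m) measurable_id fun z hz => by rw [abs_of_nonneg hz.1]; exact hz.2
  have hi2 : Integrable (fun z : ℝ => z ^ (1 + δ)) μ :=
    hbdd (C := m ^ (1 + δ)) (by fun_prop) fun z hz => by
      rw [abs_of_nonneg (Real.rpow_nonneg hz.1 _)]
      exact Real.rpow_le_rpow hz.1 hz.2 (by linarith)
  have hpt : ∀ z ∈ Icc (0:ℝ) m,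
      |z * k (a * z * u) - z - θ * a ^ δ * u ^ δ * z ^ (1 + δ)|
        ≤ ε * |θ| * a ^ δ * u ^ δ * z ^ (1 + δ) := by
    intro z hz
    have hmem : a * z * u ∈ Icc 0 (a * m) :=
      ⟨by have := hz.1; have := hu.1; positivity,
        (mul_le_of_le_one_right (mul_nonneg ha hz.1) hu.2).trans
          (mul_le_mul_of_nonneg_left hz.2 ha)⟩
    have hpow : (a * z * u) ^ δ = a ^ δ * z ^ δ * u ^ δ := by
      rw [Real.mul_rpow (mul_nonneg ha hz.1) hu.1, Real.mul_rpow ha hz.1]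
    have hz1 : z ^ (1 + δ) = z * z ^ δ := by
      rw [Real.rpow_add' hz.1 (by linarith), Real.rpow_one]
    have := mul_le_mul_of_nonneg_left (hexp _ hmem) hz.1
    rw [hpow] at this
    rw [hz1]
    calc _ = z * |k (a * z * u) - 1 - θ * (a ^ δ * z ^ δ * u ^ δ)| := by
          rw [← abs_of_nonneg hz.1, ← abs_mul, abs_of_nonneg hz.1]
          congr 1
          ring
      _ ≤ _ := this
      _ = _ := by ring
  have hi3 : Integrable (fun z : ℝ =>
      z * k (a * z * u) - z - θ * a ^ δ * u ^ δ * z ^ (1 + δ)) μ :=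
    (hi2.const_mul (ε * |θ| * a ^ δ * u ^ δ)).mono'
      (by fun_prop) (hμ.mono fun z hz => hpt z hz)
  have hi4 : Integrable (fun z : ℝ => z * k (a * z * u)) μ := by
    refine ((hi3.add (hi2.const_mul (θ * a ^ δ * u ^ δ))).add hi1).congr (ae_of_all _ fun z => ?_)
    simp only [Pi.add_apply]
    ring
  have hi5 : Integrable (fun z : ℝ => z * k (a * z * u) - z) μ := hi4.sub hi1
  have hle := norm_integral_le_of_norm_le
    (f := fun z => z * k (a * z * u) - z - θ * a ^ δ * u ^ δ * z ^ (1 + δ))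
    (hi2.const_mul (ε * |θ| * a ^ δ * u ^ δ))
    (hμ.mono fun z hz => hpt z hz)
  rw [integral_sub hi5 (hi2.const_mul _), integral_sub hi4 hi1, integral_const_mul,
    integral_const_mul, Real.norm_eq_abs] at hle
  convert hle using 1
  · congr 1
    ring
  · ring

/-- Integrating `g` against a density close to `A + D u ^ δ` on `(0, 1)`. -/
theorem abs_integral_mul_sub_le {g F : ℝ → ℝ} {δ A D E : ℝ} (hδ : 0 < δ)
    (hE : 0 ≤ E) (hg : IntegrableOn g (Ioo 0 1)) (hF : Measurable F)
    (hexp : ∀ u ∈ Ioo (0:ℝ) 1, |F u - A - D * u ^ δ| ≤ E * u ^ δ) :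
    |(∫ u in Ioo (0:ℝ) 1, g u * F u) - A * (∫ u in Ioo (0:ℝ) 1, g u)
      - D * ∫ u in Ioo (0:ℝ) 1, g u * u ^ δ| ≤ E * ∫ u in Ioo (0:ℝ) 1, |g u| := by
  have hpow : ∀ u ∈ Ioo (0:ℝ) 1, |u ^ δ| ≤ 1 := fun u hu => by
    rw [abs_of_nonneg (Real.rpow_nonneg hu.1.le _)]
    exact Real.rpow_le_one hu.1.le hu.2.le hδ.le
  have hmem : ∀ᵐ u ∂volume.restrict (Ioo (0:ℝ) 1), u ∈ Ioo (0:ℝ) 1 :=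
    ae_restrict_mem measurableSet_Ioo
  have hi1 : IntegrableOn (fun u => g u * u ^ δ) (Ioo 0 1) :=
    hg.mul_bdd (c := 1) (by fun_prop) (hmem.mono fun u hu => hpow u hu)
  have hpt : ∀ u ∈ Ioo (0:ℝ) 1, |F u - A - D * u ^ δ| ≤ E := fun u hu =>
    (hexp u hu).trans (mul_le_of_le_one_right hE ((le_abs_self _).trans (hpow u hu)))
  have hi2 : IntegrableOn (fun u => g u * (F u - A - D * u ^ δ)) (Ioo 0 1) :=
    hg.mul_bdd (c := E) (by fun_prop) (hmem.mono fun u hu => hpt u hu)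
  have hi3 : IntegrableOn (fun u => g u * F u) (Ioo 0 1) := by
    refine ((Integrable.add hi2 (hi1.const_mul D)).add (hg.const_mul A)).congr
      (ae_of_all _ fun u => ?_)
    simp only [Pi.add_apply]
    ring
  have hi4 : IntegrableOn (fun u => g u * F u - A * g u) (Ioo 0 1) :=
    Integrable.sub hi3 (hg.const_mul A)
  have heq : (∫ u in Ioo (0:ℝ) 1, g u * (F u - A - D * u ^ δ)) =
      (∫ u in Ioo (0:ℝ) 1, g u * F u) - A * (∫ u in Ioo (0:ℝ) 1, g u)
        - D * ∫ u in Ioo (0:ℝ) 1, g u * u ^ δ := by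
    rw [← integral_const_mul, ← integral_const_mul, ← integral_sub hi3 (hg.const_mul A),
      ← integral_sub hi4 (hi1.const_mul D)]
    congr with u
    ring
  rw [← heq, ← integral_const_mul]
  refine norm_integral_le_of_norm_le (f := fun u => g u * (F u - A - D * u ^ δ))
    (hg.abs.const_mul E) (hmem.mono fun u hu => ?_)
  rw [norm_mul, mul_comm]
  exact mul_le_mul_of_nonneg_right (hpt u hu) (norm_nonneg _)

/-- If `k` is within `K` of `1` near `0`, the mean of its primitive at `a z`, divided by `a`,
is close to the mean of `z`. -/
theorem abs_integral_primitive_div_sub_le {m : ℝ} (hm : 0 ≤ m) (μ : Measure ℝ)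
    [IsFiniteMeasure μ] (hμ : ∀ᵐ z ∂μ, z ∈ Icc (0:ℝ) m) {k : ℝ → ℝ} (hk : Measurable k)
    {a K : ℝ} (ha : 0 < a) (hK : ∀ v ∈ Icc 0 (a * m), |k v - 1| ≤ K) :
    |(∫ z, (∫ x in (0:ℝ)..a * z, k x) ∂μ) / a - ∫ z, z ∂μ| ≤ K * ∫ z, z ∂μ := by
  have hμr : μ.restrict (Icc 0 m) = μ := Measure.restrict_eq_self_of_ae_mem hμ
  have ham : 0 ≤ a * m := by positivity
  have hki : IntegrableOn k (Icc 0 (a * m)) := by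
    refine Measure.integrableOn_of_bounded (M := K + 1) (by simp) hk.aestronglyMeasurable ?_
    filter_upwards [ae_restrict_mem measurableSet_Icc] with v hv
    have := abs_le.1 (hK v hv)
    exact abs_le.2 ⟨by linarith, by linarith⟩
  have hi1 : Integrable (fun z : ℝ => z) μ :=
    Integrable.of_bound measurable_id.aestronglyMeasurable m
      (hμ.mono fun z hz => by rw [Real.norm_of_nonneg hz.1]; exact hz.2)
  have hpt : ∀ z ∈ Icc (0:ℝ) m, |(∫ x in (0:ℝ)..a * z, k x) / a - z| ≤ K * z := by
    intro z hz
    have haz : 0 ≤ a * z := mul_nonneg ha.le hz.1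
    have hazm : a * z ≤ a * m := mul_le_mul_of_nonneg_left hz.2 ha.le
    have hkz : IntervalIntegrable k volume 0 (a * z) := by
      rw [intervalIntegrable_iff_integrableOn_Icc_of_le haz]
      exact hki.mono_set (Icc_subset_Icc_right hazm)
    have hb := intervalIntegral.norm_integral_le_of_norm_le_const (a := 0) (b := a * z)
      (f := fun x => k x - 1) (C := K) fun x hx => by
        rw [uIoc_of_le haz] at hx
        exact hK x ⟨hx.1.le, hx.2.trans hazm⟩
    rw [intervalIntegral.integral_sub hkz (by simp), intervalIntegral.integral_const,
      sub_zero, abs_of_nonneg haz, Real.norm_eq_abs, smul_eq_mul, mul_one] at hb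
    have : (∫ x in (0:ℝ)..a * z, k x) / a - z = ((∫ x in (0:ℝ)..a * z, k x) - a * z) / a := by
      field_simp
    rw [this, abs_div, abs_of_pos ha, div_le_iff₀ ha]
    linarith
  have hmeas : AEStronglyMeasurable (fun z => (∫ x in (0:ℝ)..a * z, k x) / a - z) μ := by
    rw [← hμr]
    refine ContinuousOn.aestronglyMeasurable ?_ measurableSet_Icc
    have hc : ContinuousOn (fun y => ∫ x in (0:ℝ)..y, k x) (Icc 0 (a * m)) := by
      have := intervalIntegral.continuousOn_primitive_interval (f := k) (μ := volume)
        (a := 0) (b := a * m) (by rwa [uIcc_of_le ham])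
      rwa [uIcc_of_le ham] at this
    exact ((hc.comp (by fun_prop) fun z hz => ⟨mul_nonneg ha.le hz.1,
      mul_le_mul_of_nonneg_left hz.2 ha.le⟩).div_const a).sub continuousOn_id
  have hi2 : Integrable (fun z => (∫ x in (0:ℝ)..a * z, k x) / a - z) μ :=
    (hi1.const_mul K).mono' hmeas (hμ.mono fun z hz => hpt z hz)
  have hi3 : Integrable (fun z => (∫ x in (0:ℝ)..a * z, k x) / a) μ := by
    refine (hi2.add hi1).congr (ae_of_all _ fun z => ?_)
    simp
  have hle := norm_integral_le_of_norm_le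
    (f := fun z => (∫ x in (0:ℝ)..a * z, k x) / a - z) (hi1.const_mul K)
    (hμ.mono fun z hz => hpt z hz)
  rwa [integral_sub hi3 hi1, integral_div, integral_const_mul, Real.norm_eq_abs] at hle

/-- **Moment expansions of `Φ⁻¹(Y)` under the alternatives in the δ-model.**
With `θ n = ξ/√(n |c n|^{1+2δ})`,
`√(n |c n|) ∫_0^1 Φ⁻¹(u) (f_{θ n, c n}(u)/p(θ n, c n)) du
  → ξ (B/A) ∫ x Φ(x)^δ φ(x) dx`  and
`∫_0^1 (Φ⁻¹(u))² (f_{θ n, c n}(u)/p(θ n, c n)) du → 1`. -/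
theorem moment_expansions_delta_model
    (m δ : ℝ) (hm : 1 ≤ m) (hδ : δ ∈ Ioc (0:ℝ) 1)
    (ν : Measure ℝ) [IsProbabilityMeasure ν] (hν : ν (Icc (0:ℝ) m)ᶜ = 0)
    (A B : ℝ) (hA : A = ∫ z in Icc (0:ℝ) m, z ∂ν) (hApos : 0 < A)
    (hB : B = ∫ z in Icc (0:ℝ) m, z ^ (1 + δ) ∂ν)
    (u0 ε0 : ℝ) (hu0 : u0 ∈ Ioo (0:ℝ) 1) (hε0 : 0 < ε0)
    (h : ℝ → ℝ → ℝ) (hmeas : ∀ θ, Measurable (h θ))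
    (hnonneg : ∀ θ ∈ Icc (-ε0) ε0, ∀ u ∈ Icc (0:ℝ) u0, 0 ≤ h θ u)
    (h0 : ∀ u ∈ Icc (0:ℝ) u0, h 0 u = 1)
    (hr0 : ∀ θ ∈ Icc (-ε0) ε0, h θ 0 = 1)
    (hr : ∀ ε > 0, ∃ u1 > 0, ∀ u, 0 < u → u ≤ u1 → ∀ θ : ℝ, 0 < |θ| → |θ| ≤ ε0 →
        |h θ u - 1 - θ * u ^ δ| ≤ ε * |θ| * u ^ δ)
    (H : ℝ → ℝ → ℝ) (hH : ∀ θ y, H θ y = ∫ x in (0:ℝ)..y, h θ x)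
    (p : ℝ → ℝ → ℝ) (hp : ∀ θ c, p θ c = ∫ z in Icc (0:ℝ) m, H θ (|c| * z) ∂ν)
    (f : ℝ → ℝ → ℝ → ℝ)
    (hf : ∀ θ c u, f θ c u = |c| * ∫ z in Icc (0:ℝ) m, z * h θ (|c| * z * u) ∂ν)
    (ξ : ℝ) (c : ℕ → ℝ) (hcneg : ∀ n, c n < 0) (hc0 : Tendsto c atTop (nhds 0))
    (hnc : Tendsto (fun n : ℕ => (n : ℝ) * |c n| ^ (1 + 2 * δ)) atTop atTop)
    (θseq : ℕ → ℝ)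
    (hθ : ∀ n : ℕ, θseq n = ξ / Real.sqrt ((n : ℝ) * |c n| ^ (1 + 2 * δ))) :
    Tendsto (fun n : ℕ => Real.sqrt ((n : ℝ) * |c n|)
        * ∫ u in (0:ℝ)..1, stdNormalQuantile u
            * (f (θseq n) (c n) u / p (θseq n) (c n))) atTop
      (nhds (ξ * (B / A) * ∫ x, x * stdNormalCDF x ^ δ * gaussianPDFReal 0 1 x))
    ∧ Tendsto (fun n : ℕ =>
        ∫ u in (0:ℝ)..1, (stdNormalQuantile u) ^ 2
            * (f (θseq n) (c n) u / p (θseq n) (c n))) atTop (nhds 1) := by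
  set μ : Measure ℝ := ν.restrict (Icc 0 m) with hμdef
  have hμ : ∀ᵐ z ∂μ, z ∈ Icc (0:ℝ) m := ae_restrict_mem measurableSet_Icc
  have hδ0 : 0 < δ := hδ.1
  have hm0 : 0 < m := by linarith
  have hcpos : ∀ n, 0 < |c n| := fun n => abs_pos.2 (hcneg n).ne
  have hB0 : 0 ≤ B := by
    rw [hB]
    exact integral_nonneg_of_ae (hμ.mono fun z hz => Real.rpow_nonneg hz.1 _)
  have habs : Tendsto (fun n => |c n|) atTop (nhds 0) := by simpa using hc0.abs
  have hθ0 : Tendsto θseq atTop (nhds 0) := by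
    rw [funext hθ]
    exact (Real.tendsto_sqrt_atTop.comp hnc).const_div_atTop ξ
  have hsmall : ∀ r > 0, ∀ᶠ n in atTop, |c n| * m ≤ r := fun r hr0 => by
    have : Tendsto (fun n => |c n| * m) atTop (nhds 0) := by simpa using habs.mul_const m
    exact this.eventually_le_const hr0
  have hθsmall : ∀ᶠ n in atTop, |θseq n| ≤ ε0 := by
    have : Tendsto (fun n => |θseq n|) atTop (nhds 0) := by simpa using hθ0.abs
    exact this.eventually_le_const hε0
  have hexp : ∀ ε > 0, ∀ᶠ n in atTop, ∀ v ∈ Icc 0 (|c n| * m),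
      |h (θseq n) v - 1 - θseq n * v ^ δ| ≤ ε * |θseq n| * v ^ δ := by
    intro ε hε
    obtain ⟨u1, hu1, hb⟩ := hr ε hε
    filter_upwards [hsmall u1 hu1, hsmall u0 hu0.1, hθsmall] with n h1 h2 h3 v hv
    rcases hv.1.eq_or_lt with rfl | hv0
    · simp [hr0 _ (abs_le.1 h3), Real.zero_rpow hδ0.ne']
    · by_cases hθn : θseq n = 0
      · simp [hθn, h0 v ⟨hv.1, hv.2.trans h2⟩]
      · exact hb v hv0 (hv.2.trans h1) _ (abs_pos.2 hθn) h3
  have hpA : Tendsto (fun n => p (θseq n) (c n) / |c n|) atTop (nhds A) := by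
    have hlim : Tendsto (fun n => 2 * |θseq n| * A) atTop (nhds 0) := by
      simpa using (hθ0.abs.const_mul 2).mul_const A
    refine tendsto_iff_norm_sub_tendsto_zero.2 (squeeze_zero' (Eventually.of_forall fun _ =>
      norm_nonneg _) ?_ hlim)
    filter_upwards [hexp 1 one_pos, hsmall 1 one_pos] with n h1 h2
    have hK : ∀ v ∈ Icc 0 (|c n| * m), |h (θseq n) v - 1| ≤ 2 * |θseq n| := fun v hv => by
      have hv1 : v ^ δ ≤ 1 := Real.rpow_le_one hv.1 (hv.2.trans h2) hδ0.le
      have hv0 : 0 ≤ v ^ δ := Real.rpow_nonneg hv.1 _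
      calc |h (θseq n) v - 1|
          = |(h (θseq n) v - 1 - θseq n * v ^ δ) + θseq n * v ^ δ| := by ring_nf
        _ ≤ 1 * |θseq n| * v ^ δ + |θseq n| * v ^ δ := by
          refine (abs_add_le _ _).trans (add_le_add (h1 v hv) ?_)
          rw [abs_mul, abs_of_nonneg hv0]
        _ ≤ 2 * |θseq n| := by nlinarith [abs_nonneg (θseq n)]
    have := abs_integral_primitive_div_sub_le hm0.le μ hμ (hmeas (θseq n)) (hcpos n) hK
    simp only [hp, hH]
    rwa [← hA] at this
  set F : ℕ → ℝ → ℝ := fun n u => ∫ z, z * h (θseq n) (|c n| * z * u) ∂μ with hFdef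
  have hFmeas : ∀ n, Measurable (F n) := fun n => by
    have hmn := hmeas (θseq n)
    have : StronglyMeasurable (Function.uncurry fun u z : ℝ =>
        z * h (θseq n) (|c n| * z * u)) :=
      Measurable.stronglyMeasurable (by unfold Function.uncurry; fun_prop)
    exact this.integral_prod_right.measurable
  have hratio : ∀ (g : ℝ → ℝ) n, ∫ u in (0:ℝ)..1, g u * (f (θseq n) (c n) u / p (θseq n) (c n))
      = (∫ u in Ioo (0:ℝ) 1, g u * F n u) / (p (θseq n) (c n) / |c n|) := by
    intro g n
    rw [intervalIntegral.integral_of_le zero_le_one, integral_Ioc_eq_integral_Ioo,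
      div_div_eq_mul_div, mul_div_assoc, ← integral_mul_const]
    congr with u
    simp only [hf, hFdef]
    ring
  have hmain : ∀ g : ℝ → ℝ, IntegrableOn g (Ioo 0 1) → ∀ ε > 0, ∀ᶠ n in atTop,
      |(∫ u in Ioo (0:ℝ) 1, g u * F n u) - A * (∫ u in Ioo (0:ℝ) 1, g u)
        - θseq n * |c n| ^ δ * B * ∫ u in Ioo (0:ℝ) 1, g u * u ^ δ|
      ≤ ε * |θseq n| * |c n| ^ δ * B * ∫ u in Ioo (0:ℝ) 1, |g u| := by
    intro g hg ε hε
    filter_upwards [hexp ε hε] with n hn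
    refine abs_integral_mul_sub_le hδ0 (by positivity) hg (hFmeas n) fun u hu => ?_
    rw [hA, hB]
    exact abs_integral_mul_comp_sub_le hδ0 μ hμ (hmeas _) (hcpos n).le hn ⟨hu.1.le, hu.2.le⟩
  simp only [hratio]
  constructor
  · set J := ∫ x, x * stdNormalCDF x ^ δ * gaussianPDFReal 0 1 x with hJ
    set I := ∫ u in Ioo (0:ℝ) 1, |stdNormalQuantile u| with hI
    have hI0 : 0 ≤ I := integral_nonneg fun u => abs_nonneg _
    have hQ : IntegrableOn stdNormalQuantile (Ioo 0 1) := by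
      simpa using integrableOn_stdNormalQuantile_pow 1
    have hscale : ∀ n : ℕ, n ≠ 0 →
        Real.sqrt (n * |c n|) * (θseq n * |c n| ^ δ) = ξ := by
      intro n hn
      have hn0 : (0:ℝ) < n := by exact_mod_cast Nat.pos_of_ne_zero hn
      have hd : 0 < |c n| ^ δ := Real.rpow_pos_of_pos (hcpos n) _
      have hs : Real.sqrt (n * |c n| ^ (1 + 2 * δ)) = Real.sqrt (n * |c n|) * |c n| ^ δ := by
        rw [Real.rpow_add (hcpos n), Real.rpow_one, mul_comm 2 δ, Real.rpow_mul (hcpos n).le,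
          Real.rpow_two, ← mul_assoc, Real.sqrt_mul (by positivity), Real.sqrt_sq hd.le]
      have hs0 : 0 < Real.sqrt (n * |c n|) := Real.sqrt_pos.2 (mul_pos hn0 (hcpos n))
      rw [hθ, hs]
      field_simp
    have hnum : Tendsto (fun n : ℕ => Real.sqrt (n * |c n|)
        * ∫ u in Ioo (0:ℝ) 1, stdNormalQuantile u * F n u) atTop (nhds (ξ * B * J)) := by
      rw [Metric.tendsto_nhds]
      intro η hη
      have hden : 0 < |ξ| * B * I + 1 := by positivity
      filter_upwards [hmain _ hQ (η / (|ξ| * B * I + 1)) (by positivity),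
        eventually_ne_atTop 0] with n hn hn0
      rw [integral_stdNormalQuantile, integral_stdNormalQuantile_mul_rpow, ← hJ, ← hI,
        mul_zero, sub_zero] at hn
      have hS := Real.sqrt_nonneg ((n:ℝ) * |c n|)
      have hsc := hscale n hn0
      have hξ : Real.sqrt (n * |c n|) * (|θseq n| * |c n| ^ δ) = |ξ| := by
        rw [← hsc, abs_mul, abs_mul, abs_of_nonneg hS,
          abs_of_nonneg (Real.rpow_nonneg (hcpos n).le δ)]
      rw [Real.dist_eq]
      calc _ = |Real.sqrt (n * |c n|) * ((∫ u in Ioo (0:ℝ) 1, stdNormalQuantile u * F n u)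
              - θseq n * |c n| ^ δ * B * J)| := by
            rw [← hsc]
            congr 1
            ring
        _ ≤ Real.sqrt (n * |c n|)
              * (η / (|ξ| * B * I + 1) * |θseq n| * |c n| ^ δ * B * I) := by
            rw [abs_mul, abs_of_nonneg hS]
            exact mul_le_mul_of_nonneg_left hn hS
        _ = η / (|ξ| * B * I + 1) * (|ξ| * B * I) := by
            rw [← hξ]
            ring
        _ < η := by
            rw [div_mul_eq_mul_div, div_lt_iff₀ hden]
            linarith
    convert hnum.div hpA hApos.ne' using 2
    · exact (mul_div_assoc _ _ _).symm
    · ring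
  · have hQ := integrableOn_stdNormalQuantile_pow 2
    have hsc : Tendsto (fun n => |θseq n| * |c n| ^ δ) atTop (nhds 0) := by
      have := habs.rpow_const (p := δ) (Or.inr hδ0.le)
      simpa [Real.zero_rpow hδ0.ne'] using hθ0.abs.mul this
    have hsc' : Tendsto (fun n => θseq n * |c n| ^ δ) atTop (nhds 0) := by
      have := habs.rpow_const (p := δ) (Or.inr hδ0.le)
      simpa [Real.zero_rpow hδ0.ne'] using hθ0.mul this
    set J := ∫ u in Ioo (0:ℝ) 1, stdNormalQuantile u ^ 2 * u ^ δ
    set I := ∫ u in Ioo (0:ℝ) 1, |stdNormalQuantile u ^ 2|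
    have hrem : Tendsto (fun n => (∫ u in Ioo (0:ℝ) 1, stdNormalQuantile u ^ 2 * F n u) - A
        - θseq n * |c n| ^ δ * B * J) atTop (nhds 0) := by
      refine squeeze_zero_norm' (a := fun n => |θseq n| * |c n| ^ δ * B * I) ?_
        (by simpa using (hsc.mul_const B).mul_const I)
      filter_upwards [hmain _ hQ 1 one_pos] with n hn
      rwa [integral_stdNormalQuantile_sq, mul_one, one_mul] at hn
    have hnum : Tendsto (fun n => ∫ u in Ioo (0:ℝ) 1, stdNormalQuantile u ^ 2 * F n u) atTop
        (nhds A) := by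
      have := (hrem.add ((hsc'.mul_const B).mul_const J)).add_const A
      simpa using this
    exact div_self hApos.ne' ▸ hnum.div hpA hApos.ne'
end

section
/- Let (c_n) be a sequence in (−∞,0) with c_n → 0 and |c_n| m ≤ 1 for all n, and let (θ_n) be a sequence of nonzero reals with θ_n → 0. Then ( ∫_{[0,m]} H_{θ_n}(|c_n| z) dν(z) − |c_n| A ) / (θ_n |c_n|) → A ( C0 − ∫_0^1 T(u) du ) as n → ∞. -/
open MeasureTheory Filter Set

/-- The difference quotient of `θ ↦ exp (θ t)` at `0` is `t`, uniformly for bounded `t`. -/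
lemma abs_exp_mul_sub_one_div_sub_le {θ t K : ℝ} (hθ : θ ≠ 0) (ht : |t| ≤ K)
    (hK : |θ| * K ≤ 1) : |(Real.exp (θ * t) - 1) / θ - t| ≤ |θ| * K ^ 2 := by
  have hle : |θ * t| ≤ |θ| * K := by rw [abs_mul]; gcongr
  have hexp := Real.abs_exp_sub_one_sub_id_le (hle.trans hK)
  have heq : (Real.exp (θ * t) - 1) / θ - t = (Real.exp (θ * t) - 1 - θ * t) / θ := by
    field_simp
  rw [heq, abs_div, div_le_iff₀ (abs_pos.mpr hθ)]
  calc |Real.exp (θ * t) - 1 - θ * t| ≤ (θ * t) ^ 2 := hexp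
    _ = |θ * t| ^ 2 := (sq_abs _).symm
    _ ≤ (|θ| * K) ^ 2 := by gcongr
    _ = |θ| * K ^ 2 * |θ| := by ring

lemma eventually_ne_zero_and_abs_mul_le_one (K : ℝ) :
    ∀ᶠ θ : ℝ in nhdsWithin 0 {0}ᶜ, θ ≠ 0 ∧ |θ| * K ≤ 1 := by
  have hlim : Tendsto (fun θ : ℝ => |θ| * K) (nhdsWithin 0 {0}ᶜ) (nhds 0) := by
    have hcont : Continuous fun θ : ℝ => |θ| * K := by fun_prop
    simpa using (hcont.tendsto 0).mono_left nhdsWithin_le_nhds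
  filter_upwards [self_mem_nhdsWithin, hlim.eventually_le_const one_pos] with θ h₁ h₂
  exact ⟨h₁, h₂⟩

lemma tendsto_abs_mul_sq (K : ℝ) :
    Tendsto (fun θ : ℝ => |θ| * K ^ 2) (nhdsWithin 0 {0}ᶜ) (nhds 0) := by
  have hcont : Continuous fun θ : ℝ => |θ| * K ^ 2 := by fun_prop
  simpa using (hcont.tendsto 0).mono_left nhdsWithin_le_nhds

lemma tendsto_exp_mul_sub_one_div {T : ℝ → ℝ} {K C0 : ℝ}
    (hT : ∀ u ∈ Icc (0 : ℝ) 1, |T u| ≤ K)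
    (hC0 : Tendsto T (nhdsWithin 0 (Ioi 0)) (nhds C0)) :
    Tendsto (fun p : ℝ × ℝ => (Real.exp (p.1 * T p.2) - 1) / p.1)
      (nhdsWithin 0 {0}ᶜ ×ˢ nhdsWithin 0 (Ioi 0)) (nhds C0) := by
  have hdiff : Tendsto (fun p : ℝ × ℝ => (Real.exp (p.1 * T p.2) - 1) / p.1 - T p.2)
      (nhdsWithin 0 {0}ᶜ ×ˢ nhdsWithin 0 (Ioi 0)) (nhds 0) := by
    refine squeeze_zero_norm' ?_ ((tendsto_abs_mul_sq K).comp tendsto_fst)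
    have hu : ∀ᶠ u : ℝ in nhdsWithin 0 (Ioi 0), u ∈ Ioc (0 : ℝ) 1 := Ioc_mem_nhdsGT one_pos
    filter_upwards [(eventually_ne_zero_and_abs_mul_le_one K).prod_mk hu] with p hp
    exact abs_exp_mul_sub_one_div_sub_le hp.1.1 (hT _ (Ioc_subset_Icc_self hp.2)) hp.1.2
  simpa using hdiff.add (hC0.comp tendsto_snd)

lemma intervalIntegrable_of_abs_le {f : ℝ → ℝ} (hf : Measurable f) {K : ℝ}
    (hK : ∀ u ∈ Icc (0 : ℝ) 1, |f u| ≤ K) : IntervalIntegrable f volume 0 1 := by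
  rw [intervalIntegrable_iff_integrableOn_Icc_of_le zero_le_one]
  exact Measure.integrableOn_of_bounded (by simp) hf.aestronglyMeasurable
    ((ae_restrict_iff' measurableSet_Icc).mpr (.of_forall hK))

lemma intervalIntegrable_exp_mul {T : ℝ → ℝ} (hTm : Measurable T) {K : ℝ}
    (hT : ∀ u ∈ Icc (0 : ℝ) 1, |T u| ≤ K) (θ : ℝ) :
    IntervalIntegrable (fun u => Real.exp (θ * T u)) volume 0 1 := by
  refine intervalIntegrable_of_abs_le (K := Real.exp (|θ| * K)) (by fun_prop) fun u hu => ?_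
  rw [Real.abs_exp, Real.exp_le_exp]
  calc θ * T u ≤ |θ * T u| := le_abs_self _
    _ = |θ| * |T u| := abs_mul _ _
    _ ≤ |θ| * K := by gcongr; exact hT u hu

lemma tendsto_integral_exp_mul_sub_one_div {T : ℝ → ℝ} (hTm : Measurable T) {K : ℝ}
    (hT : ∀ u ∈ Icc (0 : ℝ) 1, |T u| ≤ K) :
    Tendsto (fun θ : ℝ => ((∫ u in (0 : ℝ)..1, Real.exp (θ * T u)) - 1) / θ)
      (nhdsWithin 0 {0}ᶜ) (nhds (∫ u in (0 : ℝ)..1, T u)) := by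
  rw [tendsto_iff_norm_sub_tendsto_zero]
  refine squeeze_zero' (.of_forall fun _ => norm_nonneg _) ?_ (tendsto_abs_mul_sq K)
  filter_upwards [eventually_ne_zero_and_abs_mul_le_one K] with θ hθ
  have hexp := intervalIntegrable_exp_mul hTm hT θ
  have heq : ((∫ u in (0 : ℝ)..1, Real.exp (θ * T u)) - 1) / θ - ∫ u in (0 : ℝ)..1, T u =
      ∫ u in (0 : ℝ)..1, ((Real.exp (θ * T u) - 1) / θ - T u) := by
    rw [intervalIntegral.integral_sub ((hexp.sub intervalIntegrable_const).div_const θ)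
      (intervalIntegrable_of_abs_le hTm hT), intervalIntegral.integral_div,
      intervalIntegral.integral_sub hexp intervalIntegrable_const]
    simp
  rw [heq]
  have hbound : ∀ u ∈ uIoc (0 : ℝ) 1,
      ‖(Real.exp (θ * T u) - 1) / θ - T u‖ ≤ |θ| * K ^ 2 := fun u hu => by
    rw [uIoc_of_le zero_le_one] at hu
    exact abs_exp_mul_sub_one_div_sub_le hθ.1 (hT u (Ioc_subset_Icc_self hu)) hθ.2
  simpa using intervalIntegral.norm_integral_le_of_norm_le_const hbound

lemma tendsto_integral_exp_mul {T : ℝ → ℝ} (hTm : Measurable T) {K : ℝ}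
    (hT : ∀ u ∈ Icc (0 : ℝ) 1, |T u| ≤ K) :
    Tendsto (fun θ : ℝ => ∫ u in (0 : ℝ)..1, Real.exp (θ * T u))
      (nhdsWithin 0 {0}ᶜ) (nhds 1) := by
  have hid : Tendsto (fun θ : ℝ => θ) (nhdsWithin 0 {0}ᶜ) (nhds 0) :=
    tendsto_id.mono_left nhdsWithin_le_nhds
  have hlim := (hid.mul (tendsto_integral_exp_mul_sub_one_div hTm hT)).const_add 1
  rw [zero_mul, add_zero] at hlim
  refine hlim.congr' ?_
  filter_upwards [self_mem_nhdsWithin] with θ hθ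
  rw [mul_div_cancel₀ _ (show θ ≠ 0 from hθ)]
  ring

/-- The score of the normalized exponential family at `θ = 0`, `u ↓ 0`. -/
lemma tendsto_normalized_exp_mul_sub_one_div {T : ℝ → ℝ} (hTm : Measurable T) {K C0 : ℝ}
    (hT : ∀ u ∈ Icc (0 : ℝ) 1, |T u| ≤ K)
    (hC0 : Tendsto T (nhdsWithin 0 (Ioi 0)) (nhds C0)) :
    Tendsto (fun p : ℝ × ℝ =>
        ((∫ u in (0 : ℝ)..1, Real.exp (p.1 * T u))⁻¹ * Real.exp (p.1 * T p.2) - 1) / p.1)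
      (nhdsWithin 0 {0}ᶜ ×ˢ nhdsWithin 0 (Ioi 0))
      (nhds (C0 - ∫ u in (0 : ℝ)..1, T u)) := by
  have hJ := tendsto_integral_exp_mul hTm hT
  have hlim := ((hJ.inv₀ one_ne_zero).comp tendsto_fst).mul
    ((tendsto_exp_mul_sub_one_div hT hC0).sub
      ((tendsto_integral_exp_mul_sub_one_div hTm hT).comp tendsto_fst))
  rw [inv_one, one_mul] at hlim
  refine hlim.congr' ?_
  have hne : ∀ᶠ p : ℝ × ℝ in nhdsWithin 0 {0}ᶜ ×ˢ nhdsWithin 0 (Ioi 0),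
      (∫ u in (0 : ℝ)..1, Real.exp (p.1 * T u)) ≠ 0 :=
    tendsto_fst.eventually (hJ.eventually_ne one_ne_zero)
  filter_upwards [hne] with p hp
  simp only [Function.comp_apply]
  rw [← sub_div, sub_sub_sub_cancel_right, ← mul_div_assoc, mul_sub, inv_mul_cancel₀ hp]

lemma abs_integral_sub_mul_le {f : ℝ → ℝ} {y a ε : ℝ} (hy : 0 ≤ y)
    (hf : IntervalIntegrable f volume 0 y) (hε : ∀ u ∈ Ioc 0 y, |f u - a| ≤ ε) :
    |(∫ u in (0 : ℝ)..y, f u) - y * a| ≤ ε * y := by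
  have heq : (∫ u in (0 : ℝ)..y, f u) - y * a = ∫ u in (0 : ℝ)..y, (f u - a) := by
    rw [intervalIntegral.integral_sub hf intervalIntegrable_const]
    simp
  rw [heq]
  have hbound := intervalIntegral.norm_integral_le_of_norm_le_const (a := 0) (b := y)
    (f := fun u => f u - a) (C := ε) (by rw [uIoc_of_le hy]; exact hε)
  simpa [abs_of_nonneg hy] using hbound

/-- If `f` is within `ε` of `a` on `(0, s m]`, then averaging its primitive over the scaled
measure `ν` gives `s a ∫ z dν` up to `ε s ∫ z dν`. -/
lemma abs_setIntegral_primitive_sub_le {f : ℝ → ℝ} (hf : IntervalIntegrable f volume 0 1)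
    {ν : Measure ℝ} [IsFiniteMeasure ν] {s m a ε : ℝ} (hs : 0 ≤ s) (hsm : s * m ≤ 1)
    (hε : ∀ u ∈ Ioc 0 (s * m), |f u - a| ≤ ε) :
    |(∫ z in Icc 0 m, (∫ u in (0 : ℝ)..(s * z), f u) ∂ν) - s * a * ∫ z in Icc 0 m, z ∂ν| ≤
      ε * s * ∫ z in Icc 0 m, z ∂ν := by
  have hmem : ∀ z ∈ Icc 0 m, s * z ∈ Icc (0 : ℝ) 1 := fun z hz =>
    ⟨mul_nonneg hs hz.1, (mul_le_mul_of_nonneg_left hz.2 hs).trans hsm⟩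
  have hid : IntegrableOn (fun z : ℝ => z) (Icc 0 m) ν :=
    continuousOn_id.integrableOn_compact isCompact_Icc
  have hprim : IntegrableOn (fun z => ∫ u in (0 : ℝ)..(s * z), f u) (Icc 0 m) ν := by
    refine ContinuousOn.integrableOn_compact isCompact_Icc ?_
    have hcont : ContinuousOn (fun y => ∫ u in (0 : ℝ)..y, f u) (Icc 0 1) := by
      simpa only [uIcc_of_le zero_le_one] using
        intervalIntegral.continuousOn_primitive_interval' hf left_mem_uIcc
    exact hcont.comp (continuous_const_mul s).continuousOn hmem
  rw [← integral_const_mul, ← integral_const_mul, ← integral_sub hprim (hid.const_mul _),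
    ← Real.norm_eq_abs]
  refine norm_integral_le_of_norm_le (hid.const_mul _) ?_
  refine (ae_restrict_iff' measurableSet_Icc).mpr (.of_forall fun z hz => ?_)
  have hsub : IntervalIntegrable f volume 0 (s * z) := by
    refine hf.mono_set ?_
    rw [uIcc_of_le (hmem z hz).1, uIcc_of_le zero_le_one]
    exact Icc_subset_Icc_right (hmem z hz).2
  have hbound := abs_integral_sub_mul_le (hmem z hz).1 hsub fun u hu =>
    hε u ⟨hu.1, hu.2.trans (mul_le_mul_of_nonneg_left hz.2 hs)⟩
  rw [Real.norm_eq_abs, mul_right_comm, mul_assoc ε]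
  exact hbound

/-- **Expansion of the exceedance probability in the exponential family model
(Fact 6).**  With `h_θ(u) = C(θ) exp(θ T(u))`, `H_θ(y) = ∫_0^y h_θ`,
`C0 = lim_{u↓0} T(u)` and `A = ∫_{[0,m]} z dν`:  for `c n < 0`, `c n → 0`,
`|c n| m ≤ 1` and nonzero `θ n → 0`,
`( ∫_{[0,m]} H_{θ n}(|c n| z) dν(z) − |c n| A ) / (θ n |c n|)
  → A (C0 − ∫_0^1 T(u) du)`. -/
theorem exceedance_prob_expansion_exponential_family
    (T : ℝ → ℝ) (hTmeas : Measurable T)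
    (K : ℝ) (hTbdd : ∀ u ∈ Icc (0:ℝ) 1, |T u| ≤ K)
    (C0 : ℝ) (hC0 : Tendsto T (nhdsWithin 0 (Ioi 0)) (nhds C0))
    (C : ℝ → ℝ) (hC : ∀ θ, C θ = (∫ u in (0:ℝ)..1, Real.exp (θ * T u))⁻¹)
    (h : ℝ → ℝ → ℝ) (hh : ∀ θ u, h θ u = C θ * Real.exp (θ * T u))
    (H : ℝ → ℝ → ℝ) (hH : ∀ θ y, H θ y = ∫ x in (0:ℝ)..y, h θ x)
    (m : ℝ) (hm : 1 ≤ m)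
    (ν : Measure ℝ) [IsProbabilityMeasure ν] (hν : ν (Icc (0:ℝ) m)ᶜ = 0)
    (A : ℝ) (hA : A = ∫ z in Icc (0:ℝ) m, z ∂ν)
    (c : ℕ → ℝ) (hcneg : ∀ n, c n < 0) (hc0 : Tendsto c atTop (nhds 0))
    (hcm : ∀ n, |c n| * m ≤ 1)
    (θ : ℕ → ℝ) (hθne : ∀ n, θ n ≠ 0) (hθ0 : Tendsto θ atTop (nhds 0)) :
    Tendsto (fun n =>
        ((∫ z in Icc (0:ℝ) m, H (θ n) (|c n| * z) ∂ν) - |c n| * A)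
          / (θ n * |c n|)) atTop
      (nhds (A * (C0 - ∫ u in (0:ℝ)..1, T u))) := by
  obtain rfl : C = fun θ => (∫ u in (0:ℝ)..1, Real.exp (θ * T u))⁻¹ := funext hC
  obtain rfl : h = _ := funext fun θ => funext (hh θ)
  obtain rfl : H = _ := funext fun θ => funext (hH θ)
  set L := C0 - ∫ u in (0:ℝ)..1, T u
  have hA0 : 0 ≤ A := hA ▸ setIntegral_nonneg measurableSet_Icc fun z hz => hz.1
  have hcm0 : Tendsto (fun n => |c n| * m) atTop (nhds 0) := by
    simpa using hc0.abs.mul_const m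
  have hθ' : Tendsto θ atTop (nhdsWithin 0 {0}ᶜ) :=
    tendsto_nhdsWithin_iff.mpr ⟨hθ0, .of_forall hθne⟩
  rw [Metric.tendsto_nhds]
  intro ε hε
  have hδ : 0 < ε / (A + 1) := by positivity
  obtain ⟨P, hP, Q, hQ, hPQ⟩ := eventually_prod_iff.mp
    (Metric.tendsto_nhds.mp (tendsto_normalized_exp_mul_sub_one_div hTmeas hTbdd hC0) _ hδ)
  obtain ⟨r, hr, hrQ⟩ := mem_nhdsGT_iff_exists_Ioo_subset.mp hQ
  filter_upwards [hθ'.eventually hP, hcm0.eventually_lt_const hr] with n hPn hrn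
  have hs : 0 < |c n| := abs_pos.mpr (hcneg n).ne
  have ht : 0 < |θ n| := abs_pos.mpr (hθne n)
  have hclose : ∀ u ∈ Ioc 0 (|c n| * m),
      |(∫ u in (0:ℝ)..1, Real.exp (θ n * T u))⁻¹ * Real.exp (θ n * T u) - (1 + θ n * L)| ≤
        ε / (A + 1) * |θ n| := fun u hu => by
    have hdist := (hPQ hPn (hrQ ⟨hu.1, hu.2.trans_lt hrn⟩)).le
    rw [Real.dist_eq] at hdist
    rw [← div_le_iff₀ ht, ← abs_div, ← sub_sub, sub_div, mul_div_cancel_left₀ _ (hθne n)]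
    exact hdist
  have hbound := abs_setIntegral_primitive_sub_le (ν := ν)
    ((intervalIntegrable_exp_mul hTmeas hTbdd (θ n)).const_mul _) hs.le (hcm n) hclose
  rw [← hA] at hbound
  rw [Real.dist_eq, div_sub' (mul_ne_zero (hθne n) hs.ne'), abs_div, abs_mul, abs_abs,
    div_lt_iff₀ (mul_pos ht hs), sub_sub]
  have heq : |c n| * A + θ n * |c n| * (A * L) = |c n| * (1 + θ n * L) * A := by ring
  rw [heq]
  refine hbound.trans_lt ?_
  calc ε / (A + 1) * |θ n| * |c n| * A = ε * (A / (A + 1)) * (|θ n| * |c n|) := by ring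
    _ < ε * 1 * (|θ n| * |c n|) := by
      gcongr
      rw [div_lt_one (by positivity)]
      exact lt_add_one A
    _ = ε * (|θ n| * |c n|) := by ring
end
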